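/- Let $K$ be an algebraically closed field of characteristic $0$ that is complete with respect to a non-trivial (possibly non-archimedean) absolute value $|\cdot|$, and let $f\in K(z)$ be a rational function of degree $d>1$, regarded as a self-map of $\mathbb{P}^1=\mathbb{P}^1(K)$. Let $[z,w]=|p_0q_1-p_1q_0|/(\|p\|\,\|q\|)$ be the normalized chordal metric on $\mathbb{P}^1$, where $p=(p_0,p_1)$ and $q=(q_0,q_1)$ are homogeneous coordinates of $z$ and $w$ and $\|\cdot\|$ is the maximum norm on $K^2$ if $K$ is non-archimedean and the Euclidean norm $\sqrt{|p_0|^2+|p_1|^2}$ if $K$ is archimedean. For a rational function $g$ let $C(g)$ be the set of critical points of $g$ in $\mathbb{P}^1$ (the points where the derivative of $g$ in local coordinates vanishes) and $\operatorname{Fix}(g)$ the set of fixed points of $g$ in $\mathbb{P}^1$, and let $\mathit{SAT}(f)=\bigcup_{n\ge 1}(\operatorname{Fix}(f^n)\cap C(f^n))$ be the set of superattracting periodic points of $f$, where $f^n$ is the $n$-th iterate of $f$. Then there exists $\delta>0$ such that for every $a\in\mathit{SAT}(f)$ and every $c\in C(f)$ satisfying $\bigcup_{j\ge 0}f^{-j}(c)\neq\{a\}$,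 one has $$\inf\Big\{[a,w]: w\in\Big(\bigcup_{j\ge 0}f^{-j}(c)\Big)\setminus\{a\}\Big\}\ge\delta.$$ Moreover, if $a\in\mathit{SAT}(f)$ and $c\in C(f)$ satisfy $\bigcup_{j\ge 0}f^{-j}(c)=\{a\}$, then $a\in\operatorname{Fix}(f)$; in particular, in that case $\bigcup_{j\ge 0}f^{-j}(c)\subset\operatorname{Fix}(f)$. -/

import Mathlib

noncomputable section

namespace RatDyn

open Polynomial

/-- The projective line `ℙ¹(K)`, i.e. `K² \ {0}` modulo scalars. The point `[t : 1]` is `t ∈ K`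
and `[1 : 0]` is `∞`. -/
abbrev P1 (K : Type*) [Field K] : Type _ := Projectivization K (Fin 2 → K)

section Chordal

variable {K : Type*} [NormedField K]

open Classical in
/-- The norm on `K²`: the maximum norm if `K` is non-archimedean, the Euclidean norm if `K` is
archimedean. -/
def vnorm (p : Fin 2 → K) : ℝ :=
  if IsUltrametricDist K then max ‖p 0‖ ‖p 1‖ else √(‖p 0‖ ^ 2 + ‖p 1‖ ^ 2)

/-- The wedge product `p ∧ q = p₀ q₁ - p₁ q₀` on `K² × K²`. -/
def wedge (p q : Fin 2 → K) : K := p 0 * q 1 - p 1 * q 0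

/-- The normalized chordal metric `[z, w] = |p ∧ q| / (‖p‖ ‖q‖)`, where `p`, `q` are any
homogeneous coordinates of `z`, `w` (see `chordal_mk`). -/
def chordal (z w : P1 K) : ℝ := ‖wedge z.rep w.rep‖ / (vnorm z.rep * vnorm w.rep)

theorem vnorm_smul (a : K) (p : Fin 2 → K) : vnorm (a • p) = ‖a‖ * vnorm p := by
  unfold vnorm
  split_ifs
  · simp [mul_max_of_nonneg]
  · simp only [Pi.smul_apply, smul_eq_mul, norm_mul, mul_pow, ← mul_add]
    rw [Real.sqrt_mul (sq_nonneg _), Real.sqrt_sq (norm_nonneg _)]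

theorem chordal_mk (p q : Fin 2 → K) (hp : p ≠ 0) (hq : q ≠ 0) :
    chordal (Projectivization.mk K p hp) (Projectivization.mk K q hq)
      = ‖wedge p q‖ / (vnorm p * vnorm q) := by
  obtain ⟨a, ha⟩ := Projectivization.exists_smul_eq_mk_rep K p hp
  obtain ⟨b, hb⟩ := Projectivization.exists_smul_eq_mk_rep K q hq
  have ha0 : ‖(a : K)‖ ≠ 0 := by simp
  have hb0 : ‖(b : K)‖ ≠ 0 := by simp
  have h : wedge ((a : K) • p) ((b : K) • q) = (a : K) * b * wedge p q := by
    simp only [wedge, Pi.smul_apply, smul_eq_mul]; ring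
  rw [chordal, ← ha, ← hb, Units.smul_def, Units.smul_def, h, vnorm_smul, vnorm_smul, norm_mul,
    norm_mul, show ‖(a : K)‖ * vnorm p * (‖(b : K)‖ * vnorm q)
      = ‖(a : K)‖ * ‖(b : K)‖ * (vnorm p * vnorm q) by ring,
    mul_div_mul_left _ _ (mul_ne_zero ha0 hb0)]

end Chordal

section RationalMap

variable {K : Type*} [Field K]

/-- The degree `max (deg P) (deg Q)` of a rational function `P / Q` in lowest terms. -/
def degree (f : RatFunc K) : ℕ := max f.num.natDegree f.denom.natDegree

/-- The value at `v` of the homogenization `∑ₖ aₖ X₀ᵏ X₁ᵈ⁻ᵏ` of a polynomial `∑ₖ aₖ Xᵏ` of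
degree at most `d`. -/
def homEval (d : ℕ) (p : K[X]) (v : Fin 2 → K) : K :=
  ∑ k ∈ Finset.range (d + 1), p.coeff k * v 0 ^ k * v 1 ^ (d - k)

/-- The homogeneous lift `K² → K²` of a rational function `P / Q` in lowest terms, given by the
degree `d` homogenizations of `P` and `Q`, where `d` is the degree of `P / Q`. -/
def homLift (f : RatFunc K) (v : Fin 2 → K) : Fin 2 → K :=
  ![homEval (degree f) f.num v, homEval (degree f) f.denom v]

theorem homEval_smul (d : ℕ) (p : K[X]) (a : K) (v : Fin 2 → K) :
    homEval d p (a • v) = a ^ d * homEval d p v := by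
  rw [homEval, homEval, Finset.mul_sum]
  refine Finset.sum_congr rfl fun k hk => ?_
  have hk' : k ≤ d := Nat.lt_succ_iff.mp (Finset.mem_range.mp hk)
  simp only [Pi.smul_apply, smul_eq_mul, mul_pow]
  rw [show a ^ d = a ^ k * a ^ (d - k) by rw [← pow_add, Nat.add_sub_cancel' hk']]
  ring

theorem homEval_of_ne (d : ℕ) (p : K[X]) (hp : p.natDegree ≤ d) (v : Fin 2 → K) (hv : v 1 ≠ 0) :
    homEval d p v = v 1 ^ d * p.eval (v 0 / v 1) := by
  rw [homEval, eval_eq_sum_range' (Nat.lt_succ_of_le hp), Finset.mul_sum]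
  refine Finset.sum_congr rfl fun k hk => ?_
  have hk' : k ≤ d := Nat.lt_succ_iff.mp (Finset.mem_range.mp hk)
  rw [show v 1 ^ d = v 1 ^ k * v 1 ^ (d - k) by rw [← pow_add, Nat.add_sub_cancel' hk'], div_pow]
  field_simp

theorem homEval_of_eq (d : ℕ) (p : K[X]) (v : Fin 2 → K) (hv : v 1 = 0) :
    homEval d p v = p.coeff d * v 0 ^ d := by
  rw [homEval, Finset.sum_eq_single d]
  · simp
  · intro k hk hkd
    have hk' : k ≤ d := Nat.lt_succ_iff.mp (Finset.mem_range.mp hk)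
    rw [hv, zero_pow (by omega), mul_zero]
  · simp

theorem homLift_ne_zero (f : RatFunc K) (v : Fin 2 → K) (hv : v ≠ 0) : homLift f v ≠ 0 := by
  intro h
  have h0 : homEval (degree f) f.num v = 0 := congrFun h 0
  have h1 : homEval (degree f) f.denom v = 0 := congrFun h 1
  by_cases hv1 : v 1 = 0
  · have hv0 : v 0 ≠ 0 := by
      intro hv0
      exact hv (by ext i; fin_cases i <;> simp [hv0, hv1])
    rw [homEval_of_eq _ _ _ hv1] at h0 h1
    have c0 : f.num.coeff (degree f) = 0 := by simpa [hv0] using h0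
    have c1 : f.denom.coeff (degree f) = 0 := by simpa [hv0] using h1
    rcases le_total f.num.natDegree f.denom.natDegree with hle | hle
    · rw [degree, max_eq_right hle] at c1
      exact f.denom_ne_zero (leadingCoeff_eq_zero.mp c1)
    · rw [degree, max_eq_left hle] at c0 c1
      have hn : f.num = 0 := leadingCoeff_eq_zero.mp c0
      have hf : f = 0 := RatFunc.num_eq_zero_iff.mp hn
      subst hf
      simp at c1
  · rw [homEval_of_ne (degree f) _ (le_max_left _ _) _ hv1] at h0
    rw [homEval_of_ne (degree f) _ (le_max_right _ _) _ hv1] at h1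
    have e0 : f.num.eval (v 0 / v 1) = 0 := by simpa [hv1] using h0
    have e1 : f.denom.eval (v 0 / v 1) = 0 := by simpa [hv1] using h1
    obtain ⟨a, b, hab⟩ := f.isCoprime_num_denom
    have := congrArg (Polynomial.eval (v 0 / v 1)) hab
    simp [e0, e1] at this

/-- The self-map of `ℙ¹(K)` induced by a rational function `f`; see `toMap_mk`. -/
def toMap (f : RatFunc K) (z : P1 K) : P1 K :=
  Projectivization.mk K (homLift f z.rep) (homLift_ne_zero f z.rep z.rep_nonzero)

theorem toMap_mk (f : RatFunc K) (v : Fin 2 → K) (hv : v ≠ 0) :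
    toMap f (Projectivization.mk K v hv)
      = Projectivization.mk K (homLift f v) (homLift_ne_zero f v hv) := by
  obtain ⟨a, ha⟩ := Projectivization.exists_smul_eq_mk_rep K v hv
  rw [toMap, Projectivization.mk_eq_mk_iff']
  refine ⟨(a : K) ^ degree f, ?_⟩
  rw [← ha, Units.smul_def]
  ext i
  fin_cases i <;> simp [homLift, homEval_smul]

/-- The two standard parametrizations `t ↦ [t : 1]` (for `i = 0`) and `t ↦ [1 : t]` (for `i = 1`)
of affine pieces of `ℙ¹(K)`. -/
def chart (i : Fin 2) (t : K) : P1 K :=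
  if i = 0 then Projectivization.mk K ![t, 1] (by simp)
  else Projectivization.mk K ![1, t] (by simp)

/-- The local coordinates `[v₀ : v₁] ↦ v₀ / v₁` (for `i = 0`) and `[v₀ : v₁] ↦ v₁ / v₀`
(for `i = 1`), inverse to `chart i` on its range. -/
def coord (i : Fin 2) (z : P1 K) : K :=
  if i = 0 then z.rep 0 / z.rep 1 else z.rep 1 / z.rep 0

theorem coord_mk (i : Fin 2) (v : Fin 2 → K) (hv : v ≠ 0) :
    coord i (Projectivization.mk K v hv) = if i = 0 then v 0 / v 1 else v 1 / v 0 := by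
  obtain ⟨a, ha⟩ := Projectivization.exists_smul_eq_mk_rep K v hv
  have ha0 : (a : K) ≠ 0 := a.ne_zero
  rw [coord, ← ha, Units.smul_def]
  simp only [Pi.smul_apply, smul_eq_mul, mul_div_mul_left _ _ ha0]

theorem coord_chart (i : Fin 2) (t : K) : coord i (chart i t) = t := by
  fin_cases i <;> simp [chart, coord_mk]

end RationalMap

section Dynamics

variable {K : Type*} [NontriviallyNormedField K]

/-- The set of critical points of a self-map `g` of `ℙ¹(K)`: the points `c` at which the
derivative of `g`, taken in local coordinates at `c` and at `g c`, is zero. -/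
def critSet (g : P1 K → P1 K) : Set (P1 K) :=
  {c | ∃ (i j : Fin 2) (s t : K), chart i s = c ∧ chart j t = g c ∧
    HasDerivAt (fun x : K => coord j (g (chart i x))) 0 s}

/-- `C(f)`, the set of critical points of `f` in `ℙ¹(K)`. -/
def Crit (f : RatFunc K) : Set (P1 K) := critSet (toMap f)

/-- `Fix(f)`, the set of fixed points of `f` in `ℙ¹(K)`. -/
def Fix (f : RatFunc K) : Set (P1 K) := Function.fixedPoints (toMap f)

/-- `SAT(f) = ⋃_{n ≥ 1} (Fix(fⁿ) ∩ C(fⁿ))`, where `fⁿ` is the `n`-th iterate: the set of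
superattracting periodic points of `f` in `ℙ¹(K)`. -/
def SAT (f : RatFunc K) : Set (P1 K) :=
  ⋃ n ∈ {n : ℕ | 1 ≤ n}, Function.fixedPoints (toMap f)^[n] ∩ critSet (toMap f)^[n]

/-- The backward orbit `⋃_{j ≥ 0} f⁻ʲ(c)` of `c ∈ ℙ¹(K)`. -/
def backOrbit (f : RatFunc K) (c : P1 K) : Set (P1 K) := ⋃ j : ℕ, (toMap f)^[j] ⁻¹' {c}

end Dynamics

end RatDyn

end

noncomputable section

namespace RatDyn

open Polynomial Filter Topology

section Charts

variable {K : Type*} [Field K]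

/-- Homogeneous coordinates of `chart i t`. -/
def chartRep (i : Fin 2) (t : K) : Fin 2 → K := if i = 0 then ![t, 1] else ![1, t]

theorem add_one_add_one (i : Fin 2) : i + 1 + 1 = i := by
  fin_cases i <;> rfl

theorem chartRep_ne_zero (i : Fin 2) (t : K) : chartRep i t ≠ 0 := by
  fin_cases i <;> simp [chartRep]

theorem chart_eq_mk (i : Fin 2) (t : K) :
    chart i t = Projectivization.mk K (chartRep i t) (chartRep_ne_zero i t) := by
  fin_cases i <;> rfl

theorem chart_injective (i : Fin 2) : Function.Injective (chart (K := K) i) :=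
  Function.LeftInverse.injective (coord_chart i)

theorem coord_mk_div (i : Fin 2) (v : Fin 2 → K) (hv : v ≠ 0) :
    coord i (Projectivization.mk K v hv) = v i / v (i + 1) := by
  rw [coord_mk]
  fin_cases i <;> simp

theorem chart_div (i : Fin 2) (v : Fin 2 → K) (hv : v ≠ 0) (h : v (i + 1) ≠ 0) :
    chart i (v i / v (i + 1)) = Projectivization.mk K v hv := by
  rw [chart_eq_mk, Projectivization.mk_eq_mk_iff']
  refine ⟨(v (i + 1))⁻¹, ?_⟩
  ext k
  fin_cases i <;> fin_cases k <;> simp [chartRep] at h ⊢ <;> field_simp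

theorem apply_ne_zero_of_chart_eq {j : Fin 2} {t : K} {v : Fin 2 → K} {hv : v ≠ 0}
    (h : chart j t = Projectivization.mk K v hv) : v (j + 1) ≠ 0 := by
  rw [chart_eq_mk, Projectivization.mk_eq_mk_iff'] at h
  obtain ⟨b, hb⟩ := h
  intro h0
  have := congrFun hb (j + 1)
  fin_cases j <;> simp_all [chartRep]

theorem coord_add_one (i : Fin 2) (z : P1 K) : coord (i + 1) z = (coord i z)⁻¹ := by
  fin_cases i <;> simp [coord]

theorem chart_add_one (i : Fin 2) {t : K} (ht : t ≠ 0) : chart (i + 1) t = chart i t⁻¹ := by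
  rw [chart_eq_mk (i + 1), ← chart_div i]
  · fin_cases i <;> simp [chartRep]
  · fin_cases i <;> simpa [chartRep] using ht

theorem chart_add_one_zero_ne (i : Fin 2) (t : K) : chart (i + 1) 0 ≠ chart i t := by
  intro h
  rw [chart_eq_mk (i + 1)] at h
  have := apply_ne_zero_of_chart_eq h.symm
  fin_cases i <;> simp [chartRep] at this

theorem chart_coord_or (i : Fin 2) (z : P1 K) : chart i (coord i z) = z ∨ z = chart (i + 1) 0 := by
  induction z using Projectivization.ind with
  | h v hv =>
    by_cases h : v (i + 1) = 0
    · right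
      have hi : v i ≠ 0 := fun h' => hv (by ext k; fin_cases i <;> fin_cases k <;> simp_all)
      rw [← chart_div (i + 1) v hv (by rwa [add_one_add_one]), h, zero_div]
    · left
      rw [coord_mk_div, chart_div i v hv h]

theorem chart_coord_of_ne_zero {i : Fin 2} {z : P1 K} (h : coord i z ≠ 0) :
    chart i (coord i z) = z := by
  rcases chart_coord_or i z with h' | h'
  · exact h'
  · have := coord_add_one i z
    rw [h', coord_chart, eq_comm, inv_eq_zero] at this
    exact absurd this (h' ▸ h)

theorem exists_chart_eq (z : P1 K) : ∃ (i : Fin 2) (t : K), chart i t = z := by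
  rcases chart_coord_or 0 z with h | h
  · exact ⟨_, _, h⟩
  · exact ⟨_, _, h.symm⟩

theorem toMap_chart (f : RatFunc K) (i : Fin 2) (x : K) :
    toMap f (chart i x) = Projectivization.mk K (homLift f (chartRep i x))
      (homLift_ne_zero f _ (chartRep_ne_zero i x)) := by
  rw [chart_eq_mk, toMap_mk]

theorem homLift_chartRep_zero (f : RatFunc K) (x : K) :
    homLift f (chartRep 0 x) = ![f.num.eval x, f.denom.eval x] := by
  rw [homLift, homEval_of_ne (degree f) _ (le_max_left _ _) _ (by simp [chartRep]),
    homEval_of_ne (degree f) _ (le_max_right _ _) _ (by simp [chartRep])]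
  simp [chartRep]

theorem finite_of_finite_affine {S : Set (P1 K)} (h : {x : K | chart 0 x ∈ S}.Finite) :
    S.Finite := by
  refine ((h.image (chart 0)).insert (chart 1 0)).subset fun z hz => ?_
  rcases chart_coord_or 0 z with h' | h'
  · exact Or.inr ⟨_, by simpa [h'] using hz, h'⟩
  · exact Or.inl h'

theorem natDegree_eq_zero_of_smul_eq {P Q : K[X]} (hQ : Q ≠ 0) (h : IsCoprime P Q) {a b : K}
    (hab : a ≠ 0 ∨ b ≠ 0) (e : C b * P = C a * Q) : P.natDegree = 0 ∧ Q.natDegree = 0 := by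
  have hb : b ≠ 0 := by
    rintro rfl
    have : a ≠ 0 := by simpa using hab
    simp_all
  have e' : P = C (b⁻¹ * a) * Q := by
    rw [C_mul, mul_assoc, ← e, ← mul_assoc, ← C_mul, inv_mul_cancel₀ hb, C_1, one_mul]
  have hu : IsUnit Q := h.symm.isUnit_of_dvd ⟨C (b⁻¹ * a), by rw [mul_comm]; exact e'⟩
  have hd := natDegree_eq_zero_of_isUnit hu
  refine ⟨?_, hd⟩
  have := natDegree_C_mul_le (b⁻¹ * a) Q
  rw [← e'] at this
  omega

/-- A nonconstant rational map has finite fibres. -/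
theorem finite_toMap_fiber {f : RatFunc K} (hf : 0 < degree f) (z : P1 K) :
    (toMap f ⁻¹' {z}).Finite := by
  apply finite_of_finite_affine
  induction z using Projectivization.ind with
  | h v hv =>
    have hR : C (v 1) * f.num - C (v 0) * f.denom ≠ 0 := by
      intro h
      have hab : v 0 ≠ 0 ∨ v 1 ≠ 0 := by
        by_contra! hc
        exact hv (by ext k; fin_cases k <;> simp [hc])
      have := natDegree_eq_zero_of_smul_eq f.denom_ne_zero f.isCoprime_num_denom hab
        (sub_eq_zero.mp h)
      simp [degree, this] at hf
    refine (finite_setOfPred_isRoot hR).subset fun x hx => ?_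
    have hx' : toMap f (chart 0 x) = Projectivization.mk K v hv := hx
    rw [toMap_chart, Projectivization.mk_eq_mk_iff'] at hx'
    obtain ⟨b, hb⟩ := hx'
    rw [homLift_chartRep_zero] at hb
    have h0 := congrFun hb 0
    have h1 := congrFun hb 1
    simp only [Pi.smul_apply, smul_eq_mul, Matrix.cons_val_zero, Matrix.cons_val_one] at h0 h1
    change IsRoot _ x
    simp only [IsRoot.def, eval_sub, eval_mul, eval_C, ← h0, ← h1]
    ring

theorem finite_iterate_fiber {f : RatFunc K} (hf : 0 < degree f) (n : ℕ) (z : P1 K) :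
    ((toMap f)^[n] ⁻¹' {z}).Finite := by
  induction n with
  | zero => simp
  | succ n ih =>
    rw [Function.iterate_succ, Set.preimage_comp]
    exact ih.preimage' fun w _ => finite_toMap_fiber hf w

end Charts

section Derivatives

variable {K : Type*} [NontriviallyNormedField K]

theorem hasDerivAt_zero_coord_change {g : P1 K → P1 K} {i j j' : Fin 2} {s t t' : K}
    (ht : chart j t = g (chart i s)) (ht' : chart j' t' = g (chart i s))
    (h : HasDerivAt (fun x : K => coord j (g (chart i x))) 0 s) :
    HasDerivAt (fun x : K => coord j' (g (chart i x))) 0 s := by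
  obtain rfl | rfl : j' = j ∨ j' = j + 1 := by fin_cases j <;> fin_cases j' <;> simp
  · exact h
  · have h0 : coord j (g (chart i s)) ≠ 0 := by
      intro h0
      have h1 := congrArg (coord (j + 1)) ht'
      rw [coord_chart, coord_add_one, h0, inv_zero] at h1
      exact chart_add_one_zero_ne j t (by rw [← h1, ht, ht'])
    simp only [coord_add_one]
    simpa using h.fun_inv h0

theorem hasDerivAt_zero_chart_change {h : P1 K → K} {i : Fin 2} {s : K} (hs : s ≠ 0)
    (hd : HasDerivAt (fun x : K => h (chart (i + 1) x)) 0 s) :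
    HasDerivAt (fun x : K => h (chart i x)) 0 s⁻¹ := by
  have hs' : s⁻¹ ≠ 0 := inv_ne_zero hs
  have h1 : HasDerivAt (fun x : K => h (chart (i + 1) x⁻¹)) 0 s⁻¹ := by
    have := HasDerivAt.comp (h₂ := fun x : K => h (chart (i + 1) x)) (h₂' := 0) s⁻¹
      (by rwa [inv_inv]) (hasDerivAt_inv hs')
    simpa [Function.comp_def] using this
  refine h1.congr_of_eventuallyEq ?_
  filter_upwards [isOpen_ne.mem_nhds hs'] with x hx
  rw [chart_add_one i (inv_ne_zero hx), inv_inv]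

theorem differentiableAt_homLift (f : RatFunc K) (i k : Fin 2) (s : K) :
    DifferentiableAt K (fun x : K => homLift f (chartRep i x) k) s := by
  fin_cases i <;> fin_cases k <;> simp only [homLift, homEval, chartRep] <;> simp <;> fun_prop

theorem differentiableAt_coord_toMap (f : RatFunc K) {i j : Fin 2} {s t : K}
    (h : chart j t = toMap f (chart i s)) :
    DifferentiableAt K (fun x : K => coord j (toMap f (chart i x))) s := by
  simp only [toMap_chart, coord_mk_div] at h ⊢
  exact (differentiableAt_homLift f i j s).fun_div (differentiableAt_homLift f i _ s)
    (apply_ne_zero_of_chart_eq h)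

/-- The map `g` has a nonzero derivative at `z` in all local coordinates. -/
def IsRegularAt (g : P1 K → P1 K) (z : P1 K) : Prop :=
  ∀ (i j : Fin 2) (s t : K), chart i s = z → chart j t = g z →
    ∃ D : K, D ≠ 0 ∧ HasDerivAt (fun x : K => coord j (g (chart i x))) D s

theorem IsRegularAt.notMem_critSet {g : P1 K → P1 K} {z : P1 K} (h : IsRegularAt g z) :
    z ∉ critSet g := by
  rintro ⟨i, j, s, t, hs, ht, hd⟩
  obtain ⟨D, hD, hd'⟩ := h i j s t hs ht
  exact hD (hd'.unique hd)

theorem isRegularAt_toMap {f : RatFunc K} {z : P1 K} (h : z ∉ Crit f) :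
    IsRegularAt (toMap f) z := by
  intro i j s t hs ht
  subst hs
  have hd := (differentiableAt_coord_toMap f ht).hasDerivAt
  exact ⟨_, fun h0 => h ⟨i, j, s, t, rfl, ht, h0 ▸ hd⟩, hd⟩

theorem IsRegularAt.comp {g h : P1 K → P1 K} {z : P1 K} (hh : IsRegularAt h (g z))
    (hg : IsRegularAt g z) : IsRegularAt (h ∘ g) z := by
  intro i k s u hs hu
  obtain ⟨j, t, ht⟩ := exists_chart_eq (g z)
  obtain ⟨D, hD, hd⟩ := hg i j s t hs ht
  obtain ⟨E, hE, he⟩ := hh j k t u ht hu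
  subst hs
  have hc : coord j (g (chart i s)) = t := by rw [← ht, coord_chart]
  refine ⟨E * D, mul_ne_zero hE hD, ?_⟩
  have hcomp := HasDerivAt.comp (h₂ := fun x : K => coord k (h (chart j x))) s
    (by rwa [hc]) hd
  refine hcomp.congr_of_eventuallyEq ?_
  have hne : ∀ᶠ x in 𝓝[≠] s, coord j (g (chart i x)) ≠ 0 := hd.eventually_ne hD
  rw [eventually_nhdsWithin_iff] at hne
  filter_upwards [hne] with x hx
  rcases eq_or_ne x s with rfl | hxs
  · simp [hc, ht]
  · simp [chart_coord_of_ne_zero (hx hxs)]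

theorem isRegularAt_id (z : P1 K) : IsRegularAt id z := by
  intro i j s t hs ht
  subst hs
  obtain rfl | rfl : j = i ∨ j = i + 1 := by fin_cases j <;> fin_cases i <;> simp
  · exact ⟨1, one_ne_zero, by simpa only [id, coord_chart] using hasDerivAt_id' s⟩
  · have hs : s ≠ 0 := by
      rintro rfl
      exact chart_add_one_zero_ne (i + 1) t (by rw [ht, id, add_one_add_one])
    refine ⟨-(s ^ 2)⁻¹, by simpa using hs, ?_⟩
    simpa [coord_add_one, coord_chart] using hasDerivAt_inv hs

theorem isRegularAt_iterate {f : RatFunc K} (n : ℕ) {z : P1 K}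
    (h : ∀ k < n, (toMap f)^[k] z ∉ Crit f) : IsRegularAt (toMap f)^[n] z := by
  induction n with
  | zero => exact isRegularAt_id z
  | succ n ih =>
    rw [Function.iterate_succ']
    exact (isRegularAt_toMap (h n (by omega))).comp (ih fun k hk => h k (by omega))

theorem finite_Crit [CharZero K] {f : RatFunc K} (hf : 0 < degree f) : (Crit f).Finite := by
  have hW : wronskian f.denom f.num ≠ 0 := by
    rw [Ne, f.isCoprime_num_denom.symm.wronskian_eq_zero_iff]
    rintro ⟨h1, h2⟩
    simp [degree, derivative_eq_zero.mp h1, derivative_eq_zero.mp h2] at hf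
  refine ((((finite_setOfPred_isRoot hW).image (chart 0)).insert (chart 1 0)).union
    (finite_toMap_fiber hf (chart 1 0))).subset ?_
  rintro c ⟨i, j, s, t, hs, ht, hd⟩
  rcases chart_coord_or 0 c with hc | hc
  swap
  · exact Or.inl (Or.inl hc)
  rcases chart_coord_or 0 (toMap f c) with hfc | hfc
  swap
  · exact Or.inr hfc
  refine Or.inl (Or.inr ⟨coord 0 c, ?_, hc⟩)
  generalize coord 0 c = x at *
  subst hc
  have hd0 : HasDerivAt (fun y : K => coord j (toMap f (chart 0 y))) 0 x := by
    obtain rfl | rfl : i = 0 ∨ i = 0 + 1 := by fin_cases i <;> simp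
    · rwa [← chart_injective 0 hs]
    · have hs0 : s ≠ 0 := by
        rintro rfl
        exact chart_add_one_zero_ne 0 x hs
      rw [chart_add_one 0 hs0] at hs
      rw [← chart_injective 0 hs]
      exact hasDerivAt_zero_chart_change (h := fun z => coord j (toMap f z)) hs0 hd
  have hd1 := hasDerivAt_zero_coord_change ht hfc hd0
  have hQ : f.denom.eval x ≠ 0 := by
    rw [toMap_chart] at hfc
    have := apply_ne_zero_of_chart_eq hfc
    simpa [homLift_chartRep_zero] using this
  simp only [toMap_chart, coord_mk_div, homLift_chartRep_zero] at hd1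
  have hd2 := (f.num.hasDerivAt x).fun_div (f.denom.hasDerivAt x) hQ
  have h0 := hd2.unique (by simpa using hd1)
  rw [div_eq_zero_iff] at h0
  have h1 := h0.resolve_right (pow_ne_zero _ hQ)
  change IsRoot _ x
  simp only [IsRoot.def, wronskian, eval_sub, eval_mul]
  linear_combination h1

theorem finite_SAT [CharZero K] {f : RatFunc K} (hf : 0 < degree f) : (SAT f).Finite := by
  have hfin : (⋃ c ∈ Crit f ∩ Function.periodicPts (toMap f),
      (fun m => (toMap f)^[m] c) '' Set.Iio (Function.minimalPeriod (toMap f) c)).Finite :=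
    ((finite_Crit hf).inter_of_left _).biUnion fun c _ => (Set.finite_Iio _).image _
  refine hfin.subset fun a ha => ?_
  simp only [SAT, Set.mem_iUnion, Set.mem_ofPred_eq] at ha
  obtain ⟨n, hn, hper, hcrit⟩ := ha
  have hper' : Function.IsPeriodicPt (toMap f) n a := hper
  obtain ⟨k, hk, hkc⟩ : ∃ k < n, (toMap f)^[k] a ∈ Crit f := by
    by_contra! h
    exact (isRegularAt_iterate n h).notMem_critSet hcrit
  have hc := hper'.apply_iterate k
  simp only [Set.mem_iUnion]
  refine ⟨_, ⟨hkc, n, hn, hc⟩, (n - k) % Function.minimalPeriod (toMap f) ((toMap f)^[k] a),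
    Nat.mod_lt _ (hc.minimalPeriod_pos hn), ?_⟩
  change (toMap f)^[_] _ = a
  rw [Function.iterate_mod_minimalPeriod_eq, ← Function.iterate_add_apply, Nat.sub_add_cancel hk.le]
  exact hper'

end Derivatives

section Separation

variable {K : Type*} [NontriviallyNormedField K]

theorem vnorm_le (p : Fin 2 → K) : vnorm p ≤ ‖p 0‖ + ‖p 1‖ := by
  have h0 := norm_nonneg (p 0)
  have h1 := norm_nonneg (p 1)
  unfold vnorm
  split_ifs
  · exact max_le (by linarith) (by linarith)
  · rw [Real.sqrt_le_left (by positivity)]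
    nlinarith

theorem vnorm_pos {p : Fin 2 → K} (hp : p ≠ 0) : 0 < vnorm p := by
  have h : 0 < ‖p 0‖ ∨ 0 < ‖p 1‖ := by
    by_contra! h
    simp only [norm_le_zero_iff] at h
    exact hp (by ext k; fin_cases k <;> simp [h])
  unfold vnorm
  split_ifs
  · exact lt_max_iff.mpr h
  · apply Real.sqrt_pos.mpr
    rcases h with h | h <;> positivity

theorem norm_wedge_chartRep (i : Fin 2) (s : K) (q : Fin 2 → K) :
    ‖wedge (chartRep i s) q‖ = ‖s * q (i + 1) - q i‖ := by
  fin_cases i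
  · simp [wedge, chartRep]
  · simp [wedge, chartRep, norm_sub_rev]

/-- Chordal discs about `chart i s` are contained in images of small discs about `s`. -/
theorem exists_chordal_lt_imp (i : Fin 2) (s : K) {ε : ℝ} (hε : 0 < ε) :
    ∃ δ > 0, ∀ w : P1 K, chordal (chart i s) w < δ → ∃ x : K, ‖x - s‖ < ε ∧ chart i x = w := by
  set M := vnorm (chartRep i s) with hM
  have hMpos : 0 < M := vnorm_pos (chartRep_ne_zero i s)
  have hS : 0 < ‖s‖ + 1 := by positivity
  set η := min (1 / 2) (ε / (2 * (‖s‖ + 1))) with hη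
  have hηpos : 0 < η := by positivity
  refine ⟨η / M, by positivity, fun w hw => ?_⟩
  induction w using Projectivization.ind with
  | h q hq =>
    rw [chart_eq_mk, chordal_mk, norm_wedge_chartRep, ← hM,
      div_lt_div_iff₀ (mul_pos hMpos (vnorm_pos hq)) hMpos] at hw
    have hlt : ‖s * q (i + 1) - q i‖ < η * vnorm q := by
      nlinarith
    have hv : vnorm q ≤ ‖q i‖ + ‖q (i + 1)‖ := by
      have := vnorm_le q
      fin_cases i
      · simpa using this
      · simpa [add_comm] using this
    have htri : ‖q i‖ ≤ ‖s‖ * ‖q (i + 1)‖ + ‖s * q (i + 1) - q i‖ := by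
      rw [← norm_mul]
      calc ‖q i‖ = ‖s * q (i + 1) - (s * q (i + 1) - q i)‖ := by rw [sub_sub_cancel]
        _ ≤ _ := norm_sub_le _ _
    set e := ‖s * q (i + 1) - q i‖ with he
    set V := ‖q (i + 1)‖ with hV
    have he0 : 0 ≤ e := norm_nonneg _
    have h1 : e < η * (e + (‖s‖ + 1) * V) :=
      hlt.trans_le (mul_le_mul_of_nonneg_left (by linarith) hηpos.le)
    have h2 : η * e ≤ 1 / 2 * e := mul_le_mul_of_nonneg_right (min_le_left _ _) he0
    have h3 : e < 2 * η * (‖s‖ + 1) * V := by nlinarith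
    have hη2 : 2 * η * (‖s‖ + 1) ≤ ε := by
      have : η ≤ ε / (2 * (‖s‖ + 1)) := min_le_right _ _
      rw [le_div_iff₀ (by positivity)] at this
      linarith
    have h4 : e < ε * V := h3.trans_le (mul_le_mul_of_nonneg_right hη2 (norm_nonneg _))
    have hq1 : q (i + 1) ≠ 0 := by
      intro h0
      rw [hV, h0, norm_zero] at h4
      linarith
    refine ⟨q i / q (i + 1), ?_, chart_div i q hq hq1⟩
    have hVpos : 0 < V := norm_pos_iff.mpr hq1
    have : q i / q (i + 1) - s = -(s * q (i + 1) - q i) / q (i + 1) := by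
      field_simp
      ring
    rwa [this, norm_div, norm_neg, div_lt_iff₀ hVpos]

theorem exists_radius_disjoint_finite {S : Set (P1 K)} (hS : S.Finite) (i : Fin 2) (s : K) :
    ∃ ε > 0, ∀ x : K, ‖x - s‖ < ε → chart i x ∈ S → x = s := by
  have hT : (chart i ⁻¹' S \ {s}).Finite :=
    (hS.preimage (chart_injective i).injOn).sdiff
  obtain ⟨ε, hε, h⟩ := Metric.isOpen_iff.mp hT.isClosed.isOpen_compl s (by simp)
  refine ⟨ε, hε, fun x hx hxS => ?_⟩
  by_contra hne
  exact h (mem_ball_iff_norm.mpr hx) ⟨hxS, hne⟩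

/-- A superattracting fixed point of a map with finite fibres has arbitrarily small invariant
discs. -/
theorem exists_invariant_radius {g : P1 K → P1 K} (hfin : ∀ z, (g ⁻¹' {z}).Finite) {a : P1 K}
    (hfix : g a = a) (hcrit : a ∈ critSet g) :
    ∃ (i : Fin 2) (s : K), chart i s = a ∧ ∃ ε₀ > 0, ∀ x : K, ‖x - s‖ < ε₀ →
      ∃ y : K, ‖y - s‖ ≤ ‖x - s‖ ∧ g (chart i x) = chart i y := by
  obtain ⟨i, j, s, t, rfl, ht, hd⟩ := hcrit
  refine ⟨i, s, rfl, ?_⟩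
  have hd' := hasDerivAt_zero_coord_change (j' := i) (t' := s) ht hfix.symm hd
  have hb := (hasDerivAt_iff_isLittleO.mp hd').bound one_pos
  obtain ⟨ε₁, hε₁, h₁⟩ := Metric.eventually_nhds_iff.mp hb
  obtain ⟨ε₂, hε₂, h₂⟩ := exists_radius_disjoint_finite (hfin (chart (i + 1) 0)) i s
  refine ⟨min ε₁ ε₂, lt_min hε₁ hε₂, fun x hx => ?_⟩
  rcases eq_or_ne x s with rfl | hxs
  · exact ⟨x, le_rfl, hfix⟩
  have hx1 := h₁ (by rw [dist_eq_norm]; exact hx.trans_le (min_le_left _ _))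
  refine ⟨coord i (g (chart i x)), ?_, ?_⟩
  · simpa [hfix, coord_chart] using hx1
  · rcases chart_coord_or i (g (chart i x)) with h | h
    · exact h.symm
    · exact absurd (h₂ x (hx.trans_le (min_le_right _ _)) h) hxs

theorem exists_chordal_ge {f : RatFunc K} (hf : 0 < degree f) {a : P1 K} (ha : a ∈ SAT f)
    (c : P1 K) : ∃ δ > 0, ∀ w ∈ backOrbit f c \ {a}, δ ≤ chordal a w := by
  simp only [SAT, Set.mem_iUnion, Set.mem_ofPred_eq] at ha
  obtain ⟨n, hn, hfix, hcrit⟩ := ha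
  obtain ⟨i, s, hs, ε₀, hε₀, hinv⟩ :=
    exists_invariant_radius (fun z => finite_iterate_fiber hf n z) hfix hcrit
  have hF : ((⋃ k ∈ Set.Iio n, (toMap f)^[k] ⁻¹' {c}) ∪ (toMap f)^[n] ⁻¹' {a}).Finite :=
    ((Set.finite_Iio n).biUnion fun k _ => finite_iterate_fiber hf k c).union
      (finite_iterate_fiber hf n a)
  obtain ⟨ε₁, hε₁, hdisj⟩ := exists_radius_disjoint_finite hF i s
  obtain ⟨δ, hδ, hball⟩ := exists_chordal_lt_imp i s (lt_min hε₀ hε₁)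
  refine ⟨δ, hδ, fun w ⟨hw, hwa⟩ => ?_⟩
  by_contra! hlt
  rw [← hs] at hlt
  obtain ⟨x, hx, rfl⟩ := hball w hlt
  apply hwa
  obtain ⟨m, hm⟩ := Set.mem_iUnion.mp hw
  have key : ∀ k : ℕ, ∀ x : K, ‖x - s‖ < min ε₀ ε₁ →
      (toMap f)^[m % n] (((toMap f)^[n])^[k] (chart i x)) = c → x = s := by
    intro k
    induction k with
    | zero =>
      intro x hx h
      exact hdisj x (hx.trans_le (min_le_right _ _))
        (Or.inl (Set.mem_biUnion (Nat.mod_lt m hn) h))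
    | succ k ih =>
      intro x hx h
      obtain ⟨y, hy, hgy⟩ := hinv x (hx.trans_le (min_le_left _ _))
      rw [Function.iterate_succ_apply, hgy] at h
      have hys := ih y (hy.trans_lt hx) h
      rw [hys, hs] at hgy
      exact hdisj x (hx.trans_le (min_le_right _ _)) (Or.inr hgy)
  rw [Set.mem_singleton_iff, ← hs, key (m / n) x hx]
  rw [← Function.iterate_mul, ← Function.iterate_add_apply, Nat.mod_add_div]
  exact hm

theorem mem_Fix_of_backOrbit_eq {f : RatFunc K} {a c : P1 K} (ha : a ∈ SAT f)
    (h : backOrbit f c = {a}) : a ∈ Fix f := by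
  simp only [SAT, Set.mem_iUnion, Set.mem_ofPred_eq] at ha
  obtain ⟨n, hn, hfix, -⟩ := ha
  have hfix' : (toMap f)^[n] a = a := hfix
  obtain ⟨n, rfl⟩ := Nat.exists_eq_add_of_le' hn
  rw [Function.iterate_succ_apply'] at hfix'
  have hca : c = a := by
    have : c ∈ backOrbit f c := Set.mem_iUnion.mpr ⟨0, rfl⟩
    rwa [h] at this
  have hb : (toMap f)^[n] a ∈ backOrbit f c :=
    Set.mem_iUnion.mpr ⟨1, by simpa [hca] using hfix'⟩
  rw [h, Set.mem_singleton_iff] at hb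
  rwa [hb] at hfix'

end Separation

end RatDyn

end

theorem separation_lemma {K : Type*} [NontriviallyNormedField K] [CompleteSpace K]
    [IsAlgClosed K] [CharZero K] (f : RatFunc K) (hf : 1 < RatDyn.degree f) :
    (∃ δ : ℝ, 0 < δ ∧
      ∀ a ∈ RatDyn.SAT f, ∀ c ∈ RatDyn.Crit f, RatDyn.backOrbit f c ≠ {a} →
        δ ≤ sInf {r : ℝ | ∃ w ∈ RatDyn.backOrbit f c \ {a}, r = RatDyn.chordal a w}) ∧
    (∀ a ∈ RatDyn.SAT f, ∀ c ∈ RatDyn.Crit f, RatDyn.backOrbit f c = {a} →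
      a ∈ RatDyn.Fix f ∧ RatDyn.backOrbit f c ⊆ RatDyn.Fix f) := by
  have hf0 : 0 < RatDyn.degree f := by omega
  refine ⟨?_, fun a ha c _ h => ?_⟩
  · have hfin := (RatDyn.finite_SAT hf0).prod (RatDyn.finite_Crit hf0)
    have hloc : ∀ p ∈ RatDyn.SAT f ×ˢ RatDyn.Crit f, ∀ᶠ δ in nhdsWithin (0 : ℝ) (Set.Ioi 0),
        ∀ w ∈ RatDyn.backOrbit f p.2 \ {p.1}, δ ≤ RatDyn.chordal p.1 w := by
      intro p hp
      obtain ⟨δ, hδ, h⟩ := RatDyn.exists_chordal_ge hf0 hp.1 p.2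
      filter_upwards [Ioo_mem_nhdsGT hδ] with η hη w hw
      exact hη.2.le.trans (h w hw)
    obtain ⟨δ, hδ, hpos⟩ :=
      (((Filter.eventually_all_finite hfin).mpr hloc).and self_mem_nhdsWithin).exists
    refine ⟨δ, hpos, fun a ha c hc hne => le_csInf ?_ ?_⟩
    · have hcc : c ∈ RatDyn.backOrbit f c := Set.mem_iUnion.mpr ⟨0, rfl⟩
      obtain ⟨w, hw, hwa⟩ : ∃ w ∈ RatDyn.backOrbit f c, w ≠ a := by
        by_contra! h
        exact hne (Set.eq_singleton_iff_nonempty_unique_mem.mpr ⟨⟨c, hcc⟩, h⟩)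
      exact ⟨_, w, ⟨hw, hwa⟩, rfl⟩
    · rintro r ⟨w, hw, rfl⟩
      exact hδ (a, c) ⟨ha, hc⟩ w hw
  · have haf := RatDyn.mem_Fix_of_backOrbit_eq ha h
    exact ⟨haf, by rw [h]; simpa using haf⟩
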